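/- arXiv:1509.06688 — 2 statements merged into one kernel-verified Lean document; each statement's English description precedes it below -/
import Mathlib

section
/- Consider the set E of surjective group homomorphisms λ : G → ℤ/4ℤ whose restriction to each finite cyclic subgroup ⟨b_j⟩, ⟨d_k⟩, ⟨e_l⟩, ⟨g_q⟩ is injective, and say λ ~ λ' when there is an admissible automorphism α of G with λ' = λ∘α. Then the number of classes of E under this relation is exactly m if r+s+t = 0, and exactly m+1 if r+s+t > 0. -/
open Monoid

/-- Index type for the factors of the free product `G(r,s,t,m,n)`. -/
abbrev Idx (r s t m n : ℕ) := Fin r ⊕ Fin s ⊕ Fin t ⊕ Fin m ⊕ Fin n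

/-- The factors: `r` copies of `ℤ`, `s` copies of `ℤ/4 × ℤ`, `t` copies of `ℤ/4`,
`m` copies of `ℤ/2 × ℤ`, and `n` copies of `ℤ/2` (written multiplicatively). -/
def Fac (r s t m n : ℕ) : Idx r s t m n → Type
  | .inl _ => Multiplicative ℤ
  | .inr (.inl _) => Multiplicative (ZMod 4 × ℤ)
  | .inr (.inr (.inl _)) => Multiplicative (ZMod 4)
  | .inr (.inr (.inr (.inl _))) => Multiplicative (ZMod 2 × ℤ)
  | .inr (.inr (.inr (.inr _))) => Multiplicative (ZMod 2)

instance (r s t m n : ℕ) : (i : Idx r s t m n) → Group (Fac r s t m n i)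
  | .inl _ => inferInstanceAs (Group (Multiplicative ℤ))
  | .inr (.inl _) => inferInstanceAs (Group (Multiplicative (ZMod 4 × ℤ)))
  | .inr (.inr (.inl _)) => inferInstanceAs (Group (Multiplicative (ZMod 4)))
  | .inr (.inr (.inr (.inl _))) => inferInstanceAs (Group (Multiplicative (ZMod 2 × ℤ)))
  | .inr (.inr (.inr (.inr _))) => inferInstanceAs (Group (Multiplicative (ZMod 2)))

/-- The group `G(r,s,t,m,n)`, the free product of the factors above; this is the orbifold
fundamental group `π₁^orb(V(Γ(v),G(v)))`. -/
abbrev OrbGroup (r s t m n : ℕ) := Monoid.CoprodI (Fac r s t m n)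

variable {r s t m n : ℕ}

/-- The free generator `a_i` of the `i`-th `ℤ` factor. -/
def genA (i : Fin r) : OrbGroup r s t m n :=
  CoprodI.of (show Fac r s t m n (.inl i) from Multiplicative.ofAdd (1 : ℤ))

/-- The order-4 generator `b_j` of the `j`-th `ℤ/4 × ℤ` factor. -/
def genB (j : Fin s) : OrbGroup r s t m n :=
  CoprodI.of (show Fac r s t m n (.inr (.inl j)) from
    Multiplicative.ofAdd ((1, 0) : ZMod 4 × ℤ))

/-- The infinite-order generator `c_j` of the `j`-th `ℤ/4 × ℤ` factor. -/
def genC (j : Fin s) : OrbGroup r s t m n :=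
  CoprodI.of (show Fac r s t m n (.inr (.inl j)) from
    Multiplicative.ofAdd ((0, 1) : ZMod 4 × ℤ))

/-- The order-4 generator `d_k` of the `k`-th `ℤ/4` factor. -/
def genD (k : Fin t) : OrbGroup r s t m n :=
  CoprodI.of (show Fac r s t m n (.inr (.inr (.inl k))) from
    Multiplicative.ofAdd (1 : ZMod 4))

/-- The order-2 generator `e_l` of the `l`-th `ℤ/2 × ℤ` factor. -/
def genE (l : Fin m) : OrbGroup r s t m n :=
  CoprodI.of (show Fac r s t m n (.inr (.inr (.inr (.inl l)))) from
    Multiplicative.ofAdd ((1, 0) : ZMod 2 × ℤ))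

/-- The infinite-order generator `f_l` of the `l`-th `ℤ/2 × ℤ` factor. -/
def genF (l : Fin m) : OrbGroup r s t m n :=
  CoprodI.of (show Fac r s t m n (.inr (.inr (.inr (.inl l)))) from
    Multiplicative.ofAdd ((0, 1) : ZMod 2 × ℤ))

/-- The order-2 generator `g_q` of the `q`-th `ℤ/2` factor. -/
def genG (q : Fin n) : OrbGroup r s t m n :=
  CoprodI.of (show Fac r s t m n (.inr (.inr (.inr (.inr q)))) from
    Multiplicative.ofAdd (1 : ZMod 2))

/-- An automorphism of `G(r,s,t,m,n)` is admissible (the algebraic characterization of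
realizable automorphisms from Lemma 2.2) if it sends each torsion-related generator to a
conjugate of the appropriate normal form. -/
def Admissible (α : OrbGroup r s t m n ≃* OrbGroup r s t m n) : Prop :=
  ∃ (σ : Equiv.Perm (Fin s)) (τ : Equiv.Perm (Fin t)) (γ : Equiv.Perm (Fin m))
    (ξ : Equiv.Perm (Fin n))
    (x : Fin s → OrbGroup r s t m n) (y : Fin t → OrbGroup r s t m n)
    (u : Fin m → OrbGroup r s t m n) (z : Fin n → OrbGroup r s t m n)
    (ε : Fin s → ℤ) (δ : Fin t → ℤ) (ε' : Fin m → ℤ) (δ' : Fin n → ℤ)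
    (v : Fin s → ℕ) (w : Fin m → ℕ),
    (∀ j, ε j = 1 ∨ ε j = -1) ∧ (∀ k, δ k = 1 ∨ δ k = -1) ∧
    (∀ l, ε' l = 1 ∨ ε' l = -1) ∧ (∀ q, δ' q = 1 ∨ δ' q = -1) ∧
    (∀ j, v j < 4) ∧ (∀ l, w l < 2) ∧
    (∀ j, α (genB j) = x j * genB (σ j) ^ ε j * (x j)⁻¹) ∧
    (∀ j, α (genC j) = x j * genB (σ j) ^ v j * genC (σ j) ^ ε j * (x j)⁻¹) ∧
    (∀ k, α (genD k) = y k * genD (τ k) ^ δ k * (y k)⁻¹) ∧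
    (∀ l, α (genE l) = u l * genE (γ l) ^ ε' l * (u l)⁻¹) ∧
    (∀ l, α (genF l) = u l * genE (γ l) ^ w l * genF (γ l) ^ ε' l * (u l)⁻¹) ∧
    (∀ q, α (genG q) = z q * genG (ξ q) ^ δ' q * (z q)⁻¹)

/-- `λ` is "finite injective": its restriction to each finite cyclic subgroup
`⟨b_j⟩`, `⟨d_k⟩`, `⟨e_l⟩`, `⟨g_q⟩` is injective. -/
def InjOnTorsion {r s t m n : ℕ}
    (lam : OrbGroup r s t m n →* Multiplicative (ZMod 4)) : Prop :=
  (∀ j : Fin s, Set.InjOn lam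
    ((Subgroup.zpowers (genB j) : Subgroup (OrbGroup r s t m n)) : Set (OrbGroup r s t m n))) ∧
  (∀ k : Fin t, Set.InjOn lam
    ((Subgroup.zpowers (genD k) : Subgroup (OrbGroup r s t m n)) : Set (OrbGroup r s t m n))) ∧
  (∀ l : Fin m, Set.InjOn lam
    ((Subgroup.zpowers (genE l) : Subgroup (OrbGroup r s t m n)) : Set (OrbGroup r s t m n))) ∧
  (∀ q : Fin n, Set.InjOn lam
    ((Subgroup.zpowers (genG q) : Subgroup (OrbGroup r s t m n)) : Set (OrbGroup r s t m n)))

/-- The set of finite injective epimorphisms `λ : G(r,s,t,m,n) → ℤ/4`, i.e. surjective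
homomorphisms injective on each finite cyclic subgroup `⟨b_j⟩`, `⟨d_k⟩`, `⟨e_l⟩`, `⟨g_q⟩`. -/
def FinInjEpi (r s t m n : ℕ) : Type :=
  {lam : OrbGroup r s t m n →* Multiplicative (ZMod 4) //
    Function.Surjective lam ∧ InjOnTorsion lam}

/-- Two finite injective epimorphisms are equivalent when they differ by composition with
an admissible automorphism of `G`. -/
def EquivRel {r s t m n : ℕ} (lam lam' : FinInjEpi r s t m n) : Prop :=
  ∃ α : OrbGroup r s t m n ≃* OrbGroup r s t m n,
    Admissible α ∧ lam'.1 = lam.1.comp α.toMonoidHom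

/-- The homomorphism from the cyclic group of order `k` sending its generator to `b`. -/
def cyclicHom {H : Type*} [Group H] (k : ℕ) (b : H) (hb : b ^ k = 1) :
    Multiplicative (ZMod k) →* H :=
  AddMonoidHom.toMultiplicativeLeft
    (ZMod.lift k ⟨zmultiplesHom (Additive H) (Additive.ofMul b), by
      simp [← ofMul_pow, hb]⟩)

theorem cyclicHom_ofAdd_one {H : Type*} [Group H] (k : ℕ) (b : H) (hb : b ^ k = 1) :
    cyclicHom k b hb (Multiplicative.ofAdd 1) = b := by
  have := ZMod.lift_coe k (⟨zmultiplesHom (Additive H) (Additive.ofMul b), by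
    simp [← ofMul_pow, hb]⟩ : {f : ℤ →+ Additive H // f k = 0}) 1
  simp only [Int.cast_one, zmultiplesHom_apply, one_smul] at this
  exact this

theorem ofAdd_intCast_zmod (k : ℕ) (z : ℤ) :
    Multiplicative.ofAdd (z : ZMod k) = Multiplicative.ofAdd (1 : ZMod k) ^ z := by
  rw [← ofAdd_zsmul]; simp

theorem cyclic_hom_ext {H : Type*} [Group H] {k : ℕ} {f g : Multiplicative (ZMod k) →* H}
    (h : f (Multiplicative.ofAdd 1) = g (Multiplicative.ofAdd 1)) : f = g := by
  refine MonoidHom.ext fun x => ?_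
  obtain ⟨z, hz⟩ := ZMod.intCast_surjective x.toAdd
  have : x = Multiplicative.ofAdd (1 : ZMod k) ^ z := by
    rw [← ofAdd_intCast_zmod, hz]; rfl
  rw [this, map_zpow, map_zpow, h]

/-- The homomorphism from `ℤ/k × ℤ` sending the two generators to commuting elements. -/
def cyclicProdHom {H : Type*} [Group H] (k : ℕ) (b c : H) (hb : b ^ k = 1)
    (hbc : Commute b c) : Multiplicative (ZMod k × ℤ) →* H :=
  (MonoidHom.noncommCoprod (cyclicHom k b hb) (zpowersHom H c) (by
    intro x y
    obtain ⟨z, hz⟩ := ZMod.intCast_surjective x.toAdd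
    have : x = Multiplicative.ofAdd (1 : ZMod k) ^ z := by
      rw [← ofAdd_intCast_zmod, hz]; rfl
    rw [this, map_zpow, cyclicHom_ofAdd_one, zpowersHom_apply]
    exact hbc.zpow_zpow _ _)).comp (MulEquiv.prodMultiplicative (ZMod k) ℤ).toMonoidHom

theorem cyclicProdHom_fst {H : Type*} [Group H] (k : ℕ) (b c : H) (hb : b ^ k = 1)
    (hbc : Commute b c) :
    cyclicProdHom k b c hb hbc (Multiplicative.ofAdd (1, 0)) = b := by
  change cyclicHom k b hb (Multiplicative.ofAdd 1) * zpowersHom H c (Multiplicative.ofAdd 0) = b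
  rw [cyclicHom_ofAdd_one]; simp

theorem cyclicProdHom_snd {H : Type*} [Group H] (k : ℕ) (b c : H) (hb : b ^ k = 1)
    (hbc : Commute b c) :
    cyclicProdHom k b c hb hbc (Multiplicative.ofAdd (0, 1)) = c := by
  change cyclicHom k b hb (Multiplicative.ofAdd 0) * zpowersHom H c (Multiplicative.ofAdd 1) = c
  simp

theorem cyclicProd_hom_ext {H : Type*} [Group H] {k : ℕ}
    {f g : Multiplicative (ZMod k × ℤ) →* H}
    (h₁ : f (Multiplicative.ofAdd (1, 0)) = g (Multiplicative.ofAdd (1, 0)))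
    (h₂ : f (Multiplicative.ofAdd (0, 1)) = g (Multiplicative.ofAdd (0, 1))) : f = g := by
  refine MonoidHom.ext fun x => ?_
  obtain ⟨z, hz⟩ := ZMod.intCast_surjective x.toAdd.1
  have : x = Multiplicative.ofAdd ((1, 0) : ZMod k × ℤ) ^ z *
      Multiplicative.ofAdd ((0, 1) : ZMod k × ℤ) ^ x.toAdd.2 := by
    rw [← ofAdd_zsmul, ← ofAdd_zsmul, ← ofAdd_add]
    apply Multiplicative.toAdd.injective
    ext <;> simp [hz]
  rw [this, map_mul, map_mul, map_zpow, map_zpow, map_zpow, map_zpow, h₁, h₂]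

/-- The inclusion of the `i`-th `ℤ` factor. -/
def inclA (i : Fin r) : Multiplicative ℤ →* OrbGroup r s t m n :=
  CoprodI.of (M := Fac r s t m n) (i := Sum.inl i)

/-- The inclusion of the `j`-th `ℤ/4 × ℤ` factor. -/
def inclBC (j : Fin s) : Multiplicative (ZMod 4 × ℤ) →* OrbGroup r s t m n :=
  CoprodI.of (M := Fac r s t m n) (i := Sum.inr (Sum.inl j))

/-- The inclusion of the `k`-th `ℤ/4` factor. -/
def inclD (k : Fin t) : Multiplicative (ZMod 4) →* OrbGroup r s t m n :=
  CoprodI.of (M := Fac r s t m n) (i := Sum.inr (Sum.inr (Sum.inl k)))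

/-- The inclusion of the `l`-th `ℤ/2 × ℤ` factor. -/
def inclEF (l : Fin m) : Multiplicative (ZMod 2 × ℤ) →* OrbGroup r s t m n :=
  CoprodI.of (M := Fac r s t m n) (i := Sum.inr (Sum.inr (Sum.inr (Sum.inl l))))

/-- The inclusion of the `q`-th `ℤ/2` factor. -/
def inclG (q : Fin n) : Multiplicative (ZMod 2) →* OrbGroup r s t m n :=
  CoprodI.of (M := Fac r s t m n) (i := Sum.inr (Sum.inr (Sum.inr (Sum.inr q))))

theorem genB_pow_four (j : Fin s) : (genB j : OrbGroup r s t m n) ^ 4 = 1 := by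
  change inclBC j (Multiplicative.ofAdd (1, 0)) ^ 4 = 1
  rw [← map_pow, ← map_one (inclBC j)]
  rfl

theorem genB_sq_ne_one (j : Fin s) : (genB j : OrbGroup r s t m n) ^ 2 ≠ 1 := by
  change inclBC j (Multiplicative.ofAdd (1, 0)) ^ 2 ≠ 1
  rw [← map_pow, ← map_one (inclBC j)]
  exact (CoprodI.of_injective _).ne (by decide : (Multiplicative.ofAdd (1, 0) :
    Multiplicative (ZMod 4 × ℤ)) ^ 2 ≠ 1)

theorem commute_genB_genC (j : Fin s) :
    Commute (genB j : OrbGroup r s t m n) (genC j) :=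
  (Commute.all (Multiplicative.ofAdd ((1, 0) : ZMod 4 × ℤ)) (Multiplicative.ofAdd (0, 1))).map
    (inclBC j)

theorem genD_pow_four (k : Fin t) : (genD k : OrbGroup r s t m n) ^ 4 = 1 := by
  change inclD k (Multiplicative.ofAdd 1) ^ 4 = 1
  rw [← map_pow, ← map_one (inclD k)]
  rfl

theorem genD_sq_ne_one (k : Fin t) : (genD k : OrbGroup r s t m n) ^ 2 ≠ 1 := by
  change inclD k (Multiplicative.ofAdd 1) ^ 2 ≠ 1
  rw [← map_pow, ← map_one (inclD k)]
  exact (CoprodI.of_injective _).ne (by decide : (Multiplicative.ofAdd 1 :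
    Multiplicative (ZMod 4)) ^ 2 ≠ 1)

theorem genE_sq (l : Fin m) : (genE l : OrbGroup r s t m n) ^ 2 = 1 := by
  change inclEF l (Multiplicative.ofAdd (1, 0)) ^ 2 = 1
  rw [← map_pow, ← map_one (inclEF l)]
  rfl

theorem genE_ne_one (l : Fin m) : (genE l : OrbGroup r s t m n) ≠ 1 := by
  change inclEF l (Multiplicative.ofAdd (1, 0)) ≠ 1
  rw [← map_one (inclEF l)]
  exact (CoprodI.of_injective _).ne (by decide : (Multiplicative.ofAdd (1, 0) :
    Multiplicative (ZMod 2 × ℤ)) ≠ 1)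

theorem commute_genE_genF (l : Fin m) :
    Commute (genE l : OrbGroup r s t m n) (genF l) :=
  (Commute.all (Multiplicative.ofAdd ((1, 0) : ZMod 2 × ℤ)) (Multiplicative.ofAdd (0, 1))).map
    (inclEF l)

theorem genG_sq (q : Fin n) : (genG q : OrbGroup r s t m n) ^ 2 = 1 := by
  change inclG q (Multiplicative.ofAdd 1) ^ 2 = 1
  rw [← map_pow, ← map_one (inclG q)]
  rfl

theorem genG_ne_one (q : Fin n) : (genG q : OrbGroup r s t m n) ≠ 1 := by
  change inclG q (Multiplicative.ofAdd 1) ≠ 1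
  rw [← map_one (inclG q)]
  exact (CoprodI.of_injective _).ne (by decide : (Multiplicative.ofAdd 1 :
    Multiplicative (ZMod 2)) ≠ 1)

/-- Images of the generators of `G(r,s,t,m,n)` in a group `H` satisfying the defining
relations. -/
structure GenImages (r s t m n : ℕ) (H : Type*) [Group H] where
  a : Fin r → H
  b : Fin s → H
  c : Fin s → H
  d : Fin t → H
  e : Fin m → H
  f : Fin m → H
  g : Fin n → H
  b_pow : ∀ j, b j ^ 4 = 1
  comm_bc : ∀ j, Commute (b j) (c j)
  d_pow : ∀ k, d k ^ 4 = 1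
  e_pow : ∀ l, e l ^ 2 = 1
  comm_ef : ∀ l, Commute (e l) (f l)
  g_pow : ∀ q, g q ^ 2 = 1

namespace GenImages

variable {H : Type*} [Group H] (D : GenImages r s t m n H)

/-- The restriction to each factor of the homomorphism prescribed on generators. -/
def factorHom : (i : Idx r s t m n) → Fac r s t m n i →* H
  | .inl i => zpowersHom H (D.a i)
  | .inr (.inl j) => cyclicProdHom 4 (D.b j) (D.c j) (D.b_pow j) (D.comm_bc j)
  | .inr (.inr (.inl k)) => cyclicHom 4 (D.d k) (D.d_pow k)
  | .inr (.inr (.inr (.inl l))) => cyclicProdHom 2 (D.e l) (D.f l) (D.e_pow l) (D.comm_ef l)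
  | .inr (.inr (.inr (.inr q))) => cyclicHom 2 (D.g q) (D.g_pow q)

/-- The homomorphism prescribed on generators. -/
def hom : OrbGroup r s t m n →* H := CoprodI.lift D.factorHom

@[simp] theorem hom_genA (i : Fin r) : D.hom (genA i) = D.a i := by
  rw [hom, genA, CoprodI.lift_of]
  exact zpow_one (D.a i)

@[simp] theorem hom_genB (j : Fin s) : D.hom (genB j) = D.b j := by
  rw [hom, genB, CoprodI.lift_of]
  exact cyclicProdHom_fst 4 _ _ (D.b_pow j) (D.comm_bc j)

@[simp] theorem hom_genC (j : Fin s) : D.hom (genC j) = D.c j := by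
  rw [hom, genC, CoprodI.lift_of]
  exact cyclicProdHom_snd 4 _ _ (D.b_pow j) (D.comm_bc j)

@[simp] theorem hom_genD (k : Fin t) : D.hom (genD k) = D.d k := by
  rw [hom, genD, CoprodI.lift_of]
  exact cyclicHom_ofAdd_one 4 _ (D.d_pow k)

@[simp] theorem hom_genE (l : Fin m) : D.hom (genE l) = D.e l := by
  rw [hom, genE, CoprodI.lift_of]
  exact cyclicProdHom_fst 2 _ _ (D.e_pow l) (D.comm_ef l)

@[simp] theorem hom_genF (l : Fin m) : D.hom (genF l) = D.f l := by
  rw [hom, genF, CoprodI.lift_of]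
  exact cyclicProdHom_snd 2 _ _ (D.e_pow l) (D.comm_ef l)

@[simp] theorem hom_genG (q : Fin n) : D.hom (genG q) = D.g q := by
  rw [hom, genG, CoprodI.lift_of]
  exact cyclicHom_ofAdd_one 2 _ (D.g_pow q)

end GenImages

theorem orbGroup_hom_ext {H : Type*} [Group H] {f g : OrbGroup r s t m n →* H}
    (hA : ∀ i, f (genA i) = g (genA i)) (hB : ∀ j, f (genB j) = g (genB j))
    (hC : ∀ j, f (genC j) = g (genC j)) (hD : ∀ k, f (genD k) = g (genD k))
    (hE : ∀ l, f (genE l) = g (genE l)) (hF : ∀ l, f (genF l) = g (genF l))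
    (hG : ∀ q, f (genG q) = g (genG q)) : f = g := by
  apply CoprodI.ext_hom
  rintro (i | j | k | l | q)
  · exact MonoidHom.ext_mint (f := f.comp (inclA i)) (g := g.comp (inclA i)) (hA i)
  · exact cyclicProd_hom_ext (f := f.comp (inclBC j)) (g := g.comp (inclBC j)) (hB j) (hC j)
  · exact cyclic_hom_ext (f := f.comp (inclD k)) (g := g.comp (inclD k)) (hD k)
  · exact cyclicProd_hom_ext (f := f.comp (inclEF l)) (g := g.comp (inclEF l)) (hE l) (hF l)
  · exact cyclic_hom_ext (f := f.comp (inclG q)) (g := g.comp (inclG q)) (hG q)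

section Automorphisms

/-- Images of the generators under the map `a ↦ a^{ε₀}`, `b ↦ b^ε`, `c ↦ b^v c^ε`, `d ↦ d^δ`,
`e ↦ e`, `f ↦ e^w f`, `g ↦ g`. -/
def twistImages (ε₀ : Fin r → ℤ) (ε : Fin s → ℤ) (v : Fin s → ℕ) (δ : Fin t → ℤ)
    (w : Fin m → ℕ) : GenImages r s t m n (OrbGroup r s t m n) where
  a i := genA i ^ ε₀ i
  b j := genB j ^ ε j
  c j := genB j ^ v j * genC j ^ ε j
  d k := genD k ^ δ k
  e := genE
  f l := genE l ^ w l * genF l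
  g := genG
  b_pow j := by
    rw [← zpow_natCast, ← zpow_mul, mul_comm, zpow_mul, zpow_natCast, genB_pow_four, one_zpow]
  comm_bc j := ((Commute.refl _).zpow_left _ |>.pow_right _).mul_right
    ((commute_genB_genC j).zpow_zpow _ _)
  d_pow k := by
    rw [← zpow_natCast, ← zpow_mul, mul_comm, zpow_mul, zpow_natCast, genD_pow_four, one_zpow]
  e_pow := genE_sq
  comm_ef l := ((Commute.refl _).pow_right _).mul_right (commute_genE_genF l)
  g_pow := genG_sq

theorem twistImages_comp {ε₀ : Fin r → ℤ} {ε : Fin s → ℤ} {v v' : Fin s → ℕ} {δ : Fin t → ℤ}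
    {w : Fin m → ℕ} (hε₀ : ∀ i, ε₀ i = 1 ∨ ε₀ i = -1) (hε : ∀ j, ε j = 1 ∨ ε j = -1)
    (hδ : ∀ k, δ k = 1 ∨ δ k = -1) (hv : ∀ j, 4 ∣ v j + v' j) :
    (twistImages (n := n) ε₀ ε v δ w).hom.comp (twistImages ε₀ ε v' δ w).hom =
      MonoidHom.id _ := by
  apply orbGroup_hom_ext
  · intro i
    rcases hε₀ i with h | h <;> simp [twistImages, h]
  · intro j
    rcases hε j with h | h <;> simp [twistImages, h]
  · intro j
    have hb : (genB j : OrbGroup r s t m n) ^ v' j = (genB j ^ v j)⁻¹ := by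
      obtain ⟨k, hk⟩ := hv j
      rw [eq_inv_iff_mul_eq_one, ← pow_add, add_comm, hk, pow_mul, genB_pow_four, one_pow]
    have hc : Commute ((genB j : OrbGroup r s t m n) ^ v j) (genC j) :=
      (commute_genB_genC j).pow_left _
    rcases hε j with h | h
    · simp [twistImages, h, hb]
    · simp [twistImages, h, hb, hc.inv_right.eq]
  · intro k
    rcases hδ k with h | h <;> simp [twistImages, h]
  · intro l
    simp [twistImages]
  · intro l
    have : (genE l : OrbGroup r s t m n) ^ w l * genE l ^ w l = 1 := by
      rw [← pow_add, ← two_mul, pow_mul, genE_sq, one_pow]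
    simp [twistImages, ← mul_assoc, this]
  · intro q
    simp [twistImages]

theorem exists_twist {ε₀ : Fin r → ℤ} {ε : Fin s → ℤ} {v : Fin s → ℕ} {δ : Fin t → ℤ}
    {w : Fin m → ℕ} (hε₀ : ∀ i, ε₀ i = 1 ∨ ε₀ i = -1) (hε : ∀ j, ε j = 1 ∨ ε j = -1)
    (hδ : ∀ k, δ k = 1 ∨ δ k = -1) (hv : ∀ j, v j < 4) (hw : ∀ l, w l < 2) :
    ∃ α : OrbGroup r s t m n ≃* OrbGroup r s t m n,
      Admissible α ∧ α.toMonoidHom = (twistImages ε₀ ε v δ w).hom := by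
  refine ⟨MonoidHom.toMulEquiv (twistImages ε₀ ε v δ w).hom
    (twistImages ε₀ ε (fun j => 3 * v j) δ w).hom
    (twistImages_comp hε₀ hε hδ fun j => ⟨v j, by ring⟩)
    (twistImages_comp hε₀ hε hδ fun j => ⟨v j, by ring⟩), ?_, rfl⟩
  refine ⟨1, 1, 1, 1, 1, 1, 1, 1, ε, δ, 1, 1, v, w, hε, hδ, fun _ => .inl rfl,
    fun _ => .inl rfl, hv, hw, ?_⟩
  simp [twistImages]

/-- Images of the generators under the map permuting the `ℤ/2 × ℤ` factors. -/
def permImages (γ : Equiv.Perm (Fin m)) : GenImages r s t m n (OrbGroup r s t m n) where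
  a := genA
  b := genB
  c := genC
  d := genD
  e l := genE (γ l)
  f l := genF (γ l)
  g := genG
  b_pow := genB_pow_four
  comm_bc := commute_genB_genC
  d_pow := genD_pow_four
  e_pow _ := genE_sq _
  comm_ef _ := commute_genE_genF _
  g_pow := genG_sq

theorem exists_perm (γ : Equiv.Perm (Fin m)) :
    ∃ α : OrbGroup r s t m n ≃* OrbGroup r s t m n,
      Admissible α ∧ α.toMonoidHom = (permImages γ).hom := by
  refine ⟨MonoidHom.toMulEquiv (permImages γ).hom (permImages γ.symm).hom ?_ ?_, ?_, rfl⟩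
  · apply orbGroup_hom_ext <;> simp [permImages]
  · apply orbGroup_hom_ext <;> simp [permImages]
  · refine ⟨1, 1, γ, 1, 1, 1, 1, 1, 1, 1, 1, 1, 0, 0, ?_⟩
    simp [permImages]

/-- Images of the generators under the map `a_i ↦ a_i c^{k_i}` fixing the other generators. -/
def transvectionImages (c : OrbGroup r s t m n) (k : Fin r → ℤ) :
    GenImages r s t m n (OrbGroup r s t m n) where
  a i := genA i * c ^ k i
  b := genB
  c := genC
  d := genD
  e := genE
  f := genF
  g := genG
  b_pow := genB_pow_four
  comm_bc := commute_genB_genC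
  d_pow := genD_pow_four
  e_pow := genE_sq
  comm_ef := commute_genE_genF
  g_pow := genG_sq

theorem transvectionImages_a (c : OrbGroup r s t m n) (k : Fin r → ℤ) (i : Fin r) :
    (transvectionImages c k).a i = genA i * c ^ k i := rfl

theorem exists_transvection (c : OrbGroup r s t m n) (k : Fin r → ℤ)
    (h₁ : (transvectionImages c k).hom c = c) (h₂ : (transvectionImages c (-k)).hom c = c) :
    ∃ α : OrbGroup r s t m n ≃* OrbGroup r s t m n,
      Admissible α ∧ α.toMonoidHom = (transvectionImages c k).hom := by
  refine ⟨MonoidHom.toMulEquiv (transvectionImages c k).hom (transvectionImages c (-k)).hom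
    ?_ ?_, ?_, rfl⟩
  · apply orbGroup_hom_ext
    · intro i
      rw [MonoidHom.comp_apply, GenImages.hom_genA, transvectionImages_a, map_mul, map_zpow, h₂,
        GenImages.hom_genA, transvectionImages_a]
      simp
    all_goals simp [transvectionImages]
  · apply orbGroup_hom_ext
    · intro i
      rw [MonoidHom.comp_apply, GenImages.hom_genA, transvectionImages_a, map_mul, map_zpow, h₁,
        GenImages.hom_genA, transvectionImages_a]
      simp
    all_goals simp [transvectionImages]
  · refine ⟨1, 1, 1, 1, 1, 1, 1, 1, 1, 1, 1, 1, 0, 0, ?_⟩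
    simp [transvectionImages]

end Automorphisms

section Torsion

theorem injOn_zpowers_iff {G H : Type*} [Group G] [Group H] (f : G →* H) (b : G) :
    Set.InjOn f (Subgroup.zpowers b : Set G) ↔ ∀ z : ℤ, f b ^ z = 1 → b ^ z = 1 := by
  constructor
  · intro h z hz
    exact h ⟨z, rfl⟩ (one_mem (Subgroup.zpowers b)) (by simpa using hz)
  · rintro h _ ⟨y, rfl⟩ _ ⟨z, rfl⟩ hyz
    have := h (y - z) (by
      simp only [map_zpow] at hyz
      rw [zpow_sub, hyz, mul_inv_cancel])
    rwa [zpow_sub, mul_inv_eq_one] at this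

theorem injOn_zpowers_of_orderOf {G H : Type*} [Group G] [Group H] {f : G →* H} {b : G}
    (h : b ^ orderOf (f b) = 1) : Set.InjOn f (Subgroup.zpowers b : Set G) := by
  rw [injOn_zpowers_iff]
  intro z hz
  obtain ⟨y, rfl⟩ := orderOf_dvd_iff_zpow_eq_one.2 hz
  rw [zpow_mul, zpow_natCast, h, one_zpow]

theorem injOn_zpowers_iff_sq_ne_one {G H : Type*} [Group G] [Group H] {f : G →* H} {b : G}
    (hb : b ^ 4 = 1) (hb' : b ^ 2 ≠ 1) :
    Set.InjOn f (Subgroup.zpowers b : Set G) ↔ f b ^ 2 ≠ 1 := by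
  constructor
  · intro h hf
    exact hb' (by simpa using (injOn_zpowers_iff f b).1 h 2 (by exact_mod_cast hf))
  · intro h
    apply injOn_zpowers_of_orderOf
    rw [orderOf_eq_prime_pow (p := 2) (n := 1) (by simpa using h)
      (by rw [← map_pow]; simp [hb])]
    simpa using hb

theorem injOn_zpowers_iff_ne_one {G H : Type*} [Group G] [Group H] {f : G →* H} {b : G}
    (hb : b ^ 2 = 1) (hb' : b ≠ 1) :
    Set.InjOn f (Subgroup.zpowers b : Set G) ↔ f b ≠ 1 := by
  constructor
  · intro h hf
    exact hb' (by simpa using (injOn_zpowers_iff f b).1 h 1 (by simpa using hf))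
  · intro h
    apply injOn_zpowers_of_orderOf
    rwa [orderOf_eq_prime (p := 2) (by rw [← map_pow, hb, map_one]) h]

theorem injOnTorsion_iff (lam : OrbGroup r s t m n →* Multiplicative (ZMod 4)) :
    InjOnTorsion lam ↔ (∀ j, lam (genB j) ^ 2 ≠ 1) ∧ (∀ k, lam (genD k) ^ 2 ≠ 1) ∧
      (∀ l, lam (genE l) ≠ 1) ∧ (∀ q, lam (genG q) ≠ 1) := by
  simp only [InjOnTorsion, injOn_zpowers_iff_sq_ne_one (genB_pow_four _) (genB_sq_ne_one _),
    injOn_zpowers_iff_sq_ne_one (genD_pow_four _) (genD_sq_ne_one _),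
    injOn_zpowers_iff_ne_one (genE_sq _) (genE_ne_one _),
    injOn_zpowers_iff_ne_one (genG_sq _) (genG_ne_one _)]

end Torsion

section NormalForm

/-- The indices `l` for which `λ(f_l)` generates `ℤ/4`. -/
def oddSet (lam : OrbGroup r s t m n →* Multiplicative (ZMod 4)) : Finset (Fin m) :=
  {l | lam (genF l) ^ 2 ≠ 1}

theorem card_oddSet_eq_of_equivRel {lam lam' : FinInjEpi r s t m n} (h : EquivRel lam lam') :
    (oddSet lam.1).card = (oddSet lam'.1).card := by
  obtain ⟨α, ⟨σ, τ, γ, ξ, x, y, u, z, ε, δ, ε', δ', v, w, -, -, hε', -, -, -, -, -, -, -, hF, -⟩,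
    hα⟩ := h
  symm
  apply Finset.card_equiv γ
  intro l
  have hE : lam.1 (genE (γ l)) ^ 2 = 1 := by rw [← map_pow, genE_sq, map_one]
  have key : lam'.1 (genF l) ^ 2 = (lam.1 (genF (γ l)) ^ 2) ^ ε' l := by
    rw [hα]
    change lam.1 (α (genF l)) ^ 2 = _
    rw [hF, map_mul, map_mul, map_mul, map_inv, map_pow, map_zpow, mul_assoc (lam.1 (u l)),
      mul_inv_cancel_comm, mul_pow, ← pow_mul, mul_comm (w l), pow_mul, hE, one_pow, one_mul,
      ← zpow_natCast, ← zpow_natCast, zpow_comm]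
  simp only [oddSet, Finset.mem_filter_univ, key]
  rcases hε' l with h | h <;> simp [h]

/-- Values on the generators of the normal form of a finite injective epimorphism with
`oddSet` equal to `S`. -/
def normalImages (S : Finset (Fin m)) : GenImages r s t m n (Multiplicative (ZMod 4)) where
  a _ := Multiplicative.ofAdd 1
  b _ := Multiplicative.ofAdd 1
  c _ := 1
  d _ := Multiplicative.ofAdd 1
  e _ := Multiplicative.ofAdd 2
  f l := if l ∈ S then Multiplicative.ofAdd 1 else 1
  g _ := Multiplicative.ofAdd 2
  b_pow _ := rfl
  comm_bc _ := Commute.all _ _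
  d_pow _ := rfl
  e_pow _ := rfl
  comm_ef _ := Commute.all _ _
  g_pow _ := rfl

theorem oddSet_normalImages (S : Finset (Fin m)) :
    oddSet (normalImages (r := r) (s := s) (t := t) (n := n) S).hom = S := by
  ext l
  by_cases h : l ∈ S
  · simpa [oddSet, normalImages, h] using by decide
  · simp [oddSet, normalImages, h]

theorem surjective_of_apply_eq_ofAdd_one {G : Type*} [Group G]
    {f : G →* Multiplicative (ZMod 4)} {x : G} (hx : f x = Multiplicative.ofAdd 1) :
    Function.Surjective f := by
  intro y
  obtain ⟨z, hz⟩ := ZMod.intCast_surjective y.toAdd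
  refine ⟨x ^ z, ?_⟩
  rw [map_zpow, hx, ← ofAdd_intCast_zmod, hz, ofAdd_toAdd]

theorem exists_generator_sq_ne_one {lam : OrbGroup r s t m n →* Multiplicative (ZMod 4)}
    (hlam : Function.Surjective lam) (hC : ∀ j, lam (genC j) = 1) :
    (∃ i, lam (genA i) ^ 2 ≠ 1) ∨ (∃ j, lam (genB j) ^ 2 ≠ 1) ∨ (∃ k, lam (genD k) ^ 2 ≠ 1) ∨
      ∃ l, lam (genF l) ^ 2 ≠ 1 := by
  by_contra! h
  obtain ⟨hA, hB, hD, hF⟩ := h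
  have : (powMonoidHom 2).comp lam = 1 := by
    apply orbGroup_hom_ext
    · simpa using hA
    · simpa using hB
    · simp [hC]
    · simpa using hD
    · intro l
      simp [← map_pow, genE_sq]
    · simpa using hF
    · intro q
      simp [← map_pow, genG_sq]
  obtain ⟨x, hx⟩ := hlam (Multiplicative.ofAdd 1)
  have hx' : lam x ^ 2 = 1 := DFunLike.congr_fun this x
  rw [hx] at hx'
  exact absurd hx' (by decide)

theorem normalImages_mem (S : Finset (Fin m)) (h : r + s + t = 0 → S.Nonempty) :
    Function.Surjective (normalImages (r := r) (s := s) (t := t) (n := n) S).hom ∧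
      InjOnTorsion (normalImages (r := r) (s := s) (t := t) (n := n) S).hom := by
  constructor
  · by_cases hr : r = 0
    · by_cases hs : s = 0
      · by_cases ht : t = 0
        · obtain ⟨l, hl⟩ := h (by omega)
          exact surjective_of_apply_eq_ofAdd_one (x := genF l) (by simp [normalImages, hl])
        · exact surjective_of_apply_eq_ofAdd_one (x := genD ⟨0, by omega⟩)
            (by simp [normalImages])
      · exact surjective_of_apply_eq_ofAdd_one (x := genB ⟨0, by omega⟩)
          (by simp [normalImages])
    · exact surjective_of_apply_eq_ofAdd_one (x := genA ⟨0, by omega⟩)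
        (by simp [normalImages])
  · rw [injOnTorsion_iff]
    simp only [GenImages.hom_genB, GenImages.hom_genD, GenImages.hom_genE, GenImages.hom_genG,
      normalImages]
    exact ⟨fun _ => by decide, fun _ => by decide, fun _ => by decide, fun _ => by decide⟩

/-- The finite injective epimorphism in normal form with `oddSet` equal to `S`. -/
def normalForm (S : Finset (Fin m)) (h : r + s + t = 0 → S.Nonempty) : FinInjEpi r s t m n :=
  ⟨(normalImages S).hom, normalImages_mem S h⟩

theorem normalForm_equivRel {S S' : Finset (Fin m)} (hS : r + s + t = 0 → S.Nonempty)
    (hS' : r + s + t = 0 → S'.Nonempty) (h : S.card = S'.card) :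
    EquivRel (normalForm (n := n) S hS) (normalForm S' hS') := by
  let e : {x // x ∈ S'} ≃ {x // x ∈ S} := Finset.equivOfCardEq h.symm
  obtain ⟨α, hα, hα'⟩ := exists_perm (r := r) (s := s) (t := t) (n := n) e.extendSubtype
  refine ⟨α, hα, ?_⟩
  rw [hα']
  apply orbGroup_hom_ext
  case hF =>
    intro l
    have : e.extendSubtype l ∈ S ↔ l ∈ S' :=
      ⟨fun hl => by_contra fun hl' => e.extendSubtype_not_mem l hl' hl, e.extendSubtype_mem l⟩
    simp [normalForm, normalImages, permImages, this]
  all_goals simp [normalForm, normalImages, permImages]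

theorem exists_twist_to_normal (lam : FinInjEpi r s t m n) :
    ∃ (lam' : FinInjEpi r s t m n) (S : Finset (Fin m)), EquivRel lam lam' ∧
      (∀ i, lam'.1 (genA i) ^ 2 ≠ 1 → lam'.1 (genA i) = Multiplicative.ofAdd 1) ∧
      (∀ j, lam'.1 (genB j) = Multiplicative.ofAdd 1) ∧
      (∀ j, lam'.1 (genC j) = 1) ∧
      (∀ k, lam'.1 (genD k) = Multiplicative.ofAdd 1) ∧
      (∀ l, lam'.1 (genE l) = Multiplicative.ofAdd 2) ∧
      (∀ l, lam'.1 (genF l) = if l ∈ S then Multiplicative.ofAdd 1 else 1) ∧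
      (∀ q, lam'.1 (genG q) = Multiplicative.ofAdd 2) := by
  obtain ⟨lam, hsurj, hinj⟩ := lam
  obtain ⟨hB, hD, hE, hG⟩ := (injOnTorsion_iff lam).1 hinj
  have sign : ∀ x : Multiplicative (ZMod 4), ∃ ε : ℤ, (ε = 1 ∨ ε = -1) ∧
      (x ^ 2 ≠ 1 → x ^ ε = Multiplicative.ofAdd 1) := by
    intro x
    have : x ^ 2 ≠ 1 → x = Multiplicative.ofAdd 1 ∨ x⁻¹ = Multiplicative.ofAdd 1 := by
      revert x; decide
    by_cases hx : x = Multiplicative.ofAdd 1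
    · exact ⟨1, .inl rfl, by simp [hx]⟩
    · exact ⟨-1, .inr rfl, fun h => by simpa using (this h).resolve_left hx⟩
  have two : ∀ x : Multiplicative (ZMod 4), x ^ 2 = 1 → x ≠ 1 → x = Multiplicative.ofAdd 2 := by
    decide
  have shift : ∀ x y : Multiplicative (ZMod 4), x ^ 2 ≠ 1 → ∃ v < 4, x ^ v * y = 1 := by
    decide
  have shift' : ∀ y : Multiplicative (ZMod 4), ∃ w < 2, Multiplicative.ofAdd 2 ^ w * y =
      if y ^ 2 ≠ 1 then Multiplicative.ofAdd 1 else 1 := by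
    decide
  have hE' l : lam (genE l) = Multiplicative.ofAdd 2 :=
    two _ (by rw [← map_pow, genE_sq, map_one]) (hE l)
  have hG' q : lam (genG q) = Multiplicative.ofAdd 2 :=
    two _ (by rw [← map_pow, genG_sq, map_one]) (hG q)
  choose ε₀ hε₀ hA' using fun i => sign (lam (genA i))
  choose ε hε hB' using fun j => sign (lam (genB j))
  choose δ hδ hD' using fun k => sign (lam (genD k))
  choose v hv hC using fun j => shift (lam (genB j)) (lam (genC j) ^ ε j) (hB j)
  choose w hw hF' using fun l => shift' (lam (genF l))
  obtain ⟨α, hα, hα'⟩ := exists_twist (n := n) hε₀ hε hδ hv hw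
  have hcomp x : (lam.comp α.toMonoidHom) x = lam ((twistImages ε₀ ε v δ w).hom x) := by
    rw [hα']; rfl
  have vA i : (lam.comp α.toMonoidHom) (genA i) = lam (genA i) ^ ε₀ i := by
    rw [hcomp]; simp [twistImages]
  have vB j : (lam.comp α.toMonoidHom) (genB j) = Multiplicative.ofAdd 1 := by
    rw [hcomp]; simp [twistImages, hB' j (hB j)]
  have vC j : (lam.comp α.toMonoidHom) (genC j) = 1 := by
    rw [hcomp]; simp [twistImages, hC]
  have vD k : (lam.comp α.toMonoidHom) (genD k) = Multiplicative.ofAdd 1 := by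
    rw [hcomp]; simp [twistImages, hD' k (hD k)]
  have vE l : (lam.comp α.toMonoidHom) (genE l) = Multiplicative.ofAdd 2 := by
    rw [hcomp]; simp [twistImages, hE']
  have vF l : (lam.comp α.toMonoidHom) (genF l) =
      if l ∈ oddSet lam then Multiplicative.ofAdd 1 else 1 := by
    rw [hcomp]; simpa [twistImages, hE', oddSet] using hF' l
  have vG q : (lam.comp α.toMonoidHom) (genG q) = Multiplicative.ofAdd 2 := by
    rw [hcomp]; simp [twistImages, hG']
  refine ⟨⟨lam.comp α.toMonoidHom, hsurj.comp α.surjective, (injOnTorsion_iff _).2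
    ⟨fun j => ?_, fun k => ?_, fun l => ?_, fun q => ?_⟩⟩, oddSet lam, ⟨α, hα, rfl⟩, fun i h => ?_,
    vB, vC, vD, vE, vF, vG⟩
  · rw [vB]; decide
  · rw [vD]; decide
  · rw [vE]; decide
  · rw [vG]; decide
  · rw [vA]
    apply hA'
    rw [vA] at h
    rcases hε₀ i with h' | h' <;> simpa [h'] using h

theorem exists_normalForm (lam : FinInjEpi r s t m n) :
    ∃ (S : Finset (Fin m)) (hS : r + s + t = 0 → S.Nonempty),
      Quot.mk EquivRel lam = Quot.mk EquivRel (normalForm S hS) := by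
  obtain ⟨lam₁, S, hrel, hA, hB, hC, hD, hE, hF, hG⟩ := exists_twist_to_normal lam
  have hgen := exists_generator_sq_ne_one lam₁.2.1 hC
  have hS : r + s + t = 0 → S.Nonempty := by
    intro h
    obtain ⟨rfl, rfl, rfl⟩ : r = 0 ∧ s = 0 ∧ t = 0 := by omega
    obtain ⟨l, hl⟩ : ∃ l, lam₁.1 (genF l) ^ 2 ≠ 1 := by simpa using hgen
    refine ⟨l, by_contra fun h => hl ?_⟩
    simp [hF, h]
  refine ⟨S, hS, (Quot.sound hrel).trans (Quot.sound ?_)⟩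
  let k : Fin r → ℤ := fun i => ((1 - (lam₁.1 (genA i)).toAdd).val : ℕ)
  obtain ⟨c, hc, h₁, h₂⟩ : ∃ c, lam₁.1 c = Multiplicative.ofAdd 1 ∧
      (transvectionImages c k).hom c = c ∧ (transvectionImages c (-k)).hom c = c := by
    rcases hgen with ⟨i, hi⟩ | ⟨j, -⟩ | ⟨i, -⟩ | ⟨l, hl⟩
    · have hk : k i = 0 := by simp [k, hA i hi]
      exact ⟨genA i, hA i hi, by simp [transvectionImages, hk], by simp [transvectionImages, hk]⟩
    · exact ⟨genB j, hB j, by simp [transvectionImages], by simp [transvectionImages]⟩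
    · exact ⟨genD i, hD i, by simp [transvectionImages], by simp [transvectionImages]⟩
    · have hlS : l ∈ S := by_contra fun h => hl (by simp [hF, h])
      exact ⟨genF l, by simp [hF, hlS], by simp [transvectionImages],
        by simp [transvectionImages]⟩
  obtain ⟨α, hα, hα'⟩ := exists_transvection c k h₁ h₂
  refine ⟨α, hα, ?_⟩
  rw [hα']
  apply orbGroup_hom_ext
  case hA =>
    intro i
    rw [MonoidHom.comp_apply, GenImages.hom_genA, transvectionImages_a, map_mul, map_zpow, hc]
    simp only [normalForm, GenImages.hom_genA, normalImages, k]
    rw [← ofAdd_intCast_zmod]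
    simp [ofAdd_sub]
  all_goals simp [normalForm, normalImages, transvectionImages, hB, hC, hD, hE, hF, hG]

end NormalForm

/-- Algebraic heart of Theorem 1.1: the number of classes of finite injective epimorphisms
`G(r,s,t,m,n) → ℤ/4` under the equivalence induced by admissible automorphisms is `m` if
`r + s + t = 0` and `m + 1` if `r + s + t > 0`. -/
theorem card_classes {r s t m n : ℕ} (h : 0 < r + s + t + m + n) :
    Nat.card (Quot (EquivRel (r := r) (s := s) (t := t) (m := m) (n := n))) =
      if r + s + t = 0 then m else m + 1 := by
  let N : Quot (EquivRel (r := r) (s := s) (t := t) (m := m) (n := n)) → ℕ :=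
    Quot.lift (fun lam => (oddSet lam.1).card) fun _ _ => card_oddSet_eq_of_equivRel
  have hN (S : Finset (Fin m)) (hS) : N (Quot.mk _ (normalForm S hS)) = S.card :=
    congrArg Finset.card (oddSet_normalImages S)
  have hinj : Function.Injective N := by
    rintro ⟨lam⟩ ⟨lam'⟩ hc
    obtain ⟨S, hS, hmk⟩ := exists_normalForm lam
    obtain ⟨S', hS', hmk'⟩ := exists_normalForm lam'
    rw [hmk, hmk', hN, hN] at hc
    rw [hmk, hmk']
    exact Quot.sound (normalForm_equivRel hS hS' hc)
  have hrange : Set.range N = Finset.Icc (if r + s + t = 0 then 1 else 0) m := by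
    ext c
    simp only [Set.mem_range, Finset.coe_Icc, Set.mem_Icc]
    constructor
    · rintro ⟨⟨lam⟩, rfl⟩
      obtain ⟨S, hS, hmk⟩ := exists_normalForm lam
      rw [hmk, hN]
      refine ⟨?_, by simpa using Finset.card_le_univ S⟩
      split_ifs with h0
      · exact Finset.card_pos.2 (hS h0)
      · exact Nat.zero_le _
    · rintro ⟨hlow, hup⟩
      obtain ⟨S, -, rfl⟩ := Finset.exists_subset_card_eq
        (s := (Finset.univ : Finset (Fin m))) (n := c) (by simpa using hup)
      refine ⟨Quot.mk _ (normalForm S fun h0 => ?_), hN S _⟩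
      rw [if_pos h0] at hlow
      exact Finset.card_pos.1 hlow
  rw [← Nat.card_range_of_injective hinj, hrange, Nat.card_coe_set_eq, Set.ncard_coe_finset,
    Nat.card_Icc]
  split_ifs <;> omega
end

section
/- Let λ : G → ℤ/4ℤ be a surjective group homomorphism whose restriction to each finite cyclic subgroup ⟨b_j⟩, ⟨d_k⟩, ⟨e_l⟩, ⟨g_q⟩ is injective. Then the kernel of λ is a free group of rank g = 4(r+s+m)+3t+2n−3; that is, ker λ is isomorphic to the free group on 4(r+s+m)+3t+2n−3 generators. -/
open Monoid

variable {r s t m n : ℕ}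

open Function

/-- A one-cocycle on `H × Q` with values in `X`, for the action of `H` on `Q` by left
multiplication through `φ`; equivalently, a functor from the action groupoid to `X`. -/
@[ext]
structure ActionCocycle {H Q : Type} [Group H] [Group Q] (φ : H →* Q) (X : Type) [Group X] where
  toFun : H → Q → X
  toFun_mul : ∀ g h q, toFun (g * h) q = toFun g (φ h * q) * toFun h q

namespace ActionCocycle

variable {H Q X Y : Type} [Group H] [Group Q] [Group X] [Group Y] {φ : H →* Q}

lemma toFun_one (c : ActionCocycle φ X) (q : Q) : c.toFun 1 q = 1 := by
  simpa using c.toFun_mul 1 1 q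

/-- Pushing a cocycle forward along a homomorphism. -/
def map (c : ActionCocycle φ X) (f : X →* Y) : ActionCocycle φ Y where
  toFun h q := f (c.toFun h q)
  toFun_mul g h q := by rw [c.toFun_mul, map_mul]

/-- A cocycle restricts to a homomorphism on the stabilizer of a point. -/
def onKer (c : ActionCocycle φ X) (q : Q) : φ.ker →* X where
  toFun k := c.toFun k q
  map_one' := c.toFun_one q
  map_mul' k l := by
    have := c.toFun_mul k l q
    rwa [MonoidHom.mem_ker.1 l.2, one_mul] at this

/-- Restriction of a cocycle along a homomorphism. -/
def comp {H' : Type} [Group H'] (c : ActionCocycle φ X) (f : H' →* H) :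
    ActionCocycle (φ.comp f) X where
  toFun h q := c.toFun (f h) q
  toFun_mul g h q := by rw [map_mul, c.toFun_mul]; rfl

/-- The action of the source group on `Q × X` determined by a cocycle. -/
def toPerm (c : ActionCocycle φ X) : H →* Equiv.Perm (Q × X) where
  toFun h :=
    { toFun := fun p => (φ h * p.1, c.toFun h p.1 * p.2)
      invFun := fun p => (φ h⁻¹ * p.1, c.toFun h⁻¹ p.1 * p.2)
      left_inv := fun p => by
        have := c.toFun_mul h⁻¹ h p.1
        rw [inv_mul_cancel, c.toFun_one] at this
        ext <;> simp [← mul_assoc, ← this]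
      right_inv := fun p => by
        have := c.toFun_mul h h⁻¹ p.1
        rw [mul_inv_cancel, c.toFun_one, map_inv] at this
        ext <;> simp [← mul_assoc, ← this] }
  map_one' := by ext p <;> simp [c.toFun_one]
  map_mul' g h := by ext p <;> simp [c.toFun_mul, mul_assoc]

@[simp]
lemma toPerm_apply (c : ActionCocycle φ X) (h : H) (p : Q × X) :
    c.toPerm h p = (φ h * p.1, c.toFun h p.1 * p.2) := rfl

end ActionCocycle

/-- A family of pairs is a basis if cocycles are freely determined by their values on it, i.e. the
action groupoid is free on these arrows. -/
def IsCocycleBasis {H Q E : Type} [Group H] [Group Q] (φ : H →* Q) (b : E → H × Q) : Prop :=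
  ∀ (X : Type) [Group X],
    Bijective fun (c : ActionCocycle φ X) (e : E) => c.toFun (b e).1 (b e).2

section Coprod

variable {ι Q : Type} {M : ι → Type} [∀ i, Group (M i)] [Group Q]

lemma ActionCocycle.ext_coprod {X : Type} [Group X] {φ : CoprodI M →* Q}
    {c d : ActionCocycle φ X}
    (h : ∀ i (x : M i) q, c.toFun (CoprodI.of x) q = d.toFun (CoprodI.of x) q) : c = d := by
  ext g q
  induction g using CoprodI.induction_on generalizing q with
  | one => rw [c.toFun_one, d.toFun_one]
  | of i x => exact h i x q
  | mul x y hx hy => rw [c.toFun_mul, d.toFun_mul, hx, hy]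

lemma ActionCocycle.exists_coprod {X : Type} [Group X] {φ : CoprodI M →* Q}
    (c : ∀ i, ActionCocycle (φ.comp (CoprodI.of (i := i))) X) :
    ∃ d : ActionCocycle φ X, ∀ i (x : M i) q, d.toFun (CoprodI.of x) q = (c i).toFun x q := by
  let F : CoprodI M →* Equiv.Perm (Q × X) := CoprodI.lift fun i => (c i).toPerm
  have hF : ∀ g q x, F g (q, x) = (φ g * q, (F g (q, 1)).2 * x) := by
    intro g
    induction g using CoprodI.induction_on with
    | one => simp
    | of i y => simp [F]
    | mul g h hg hh =>
      intro q x
      rw [map_mul, Equiv.Perm.mul_apply, Equiv.Perm.mul_apply, hh, hg, hh q 1, hg _ (_ * 1)]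
      simp [mul_assoc]
  refine ⟨⟨fun g q => (F g (q, 1)).2, fun g h q => ?_⟩, fun i x q => by simp [F]⟩
  rw [map_mul, Equiv.Perm.mul_apply, hF h q 1, hF g]

lemma IsCocycleBasis.coprod {φ : CoprodI M →* Q} {E : ι → Type} {b : ∀ i, E i → M i × Q}
    (hb : ∀ i, IsCocycleBasis (φ.comp (CoprodI.of (i := i))) (b i)) :
    IsCocycleBasis φ
      (fun e : Σ i, E i => ((CoprodI.of (b e.1 e.2).1 : CoprodI M), (b e.1 e.2).2)) := by
  intro X _
  constructor
  · intro c d hcd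
    refine ActionCocycle.ext_coprod fun i x q => ?_
    have : c.comp (CoprodI.of (i := i)) = d.comp (CoprodI.of (i := i)) :=
      (hb i X).1 (funext fun e => congrFun hcd ⟨i, e⟩)
    exact congrFun (congrFun (congrArg ActionCocycle.toFun this) x) q
  · intro f
    choose c hc using fun i => (hb i X).2 fun e => f ⟨i, e⟩
    obtain ⟨d, hd⟩ := ActionCocycle.exists_coprod c
    exact ⟨d, funext fun ⟨i, e⟩ => (hd i _ _).trans (congrFun (hc i) e)⟩

end Coprod

section Kernel

variable {H Q : Type} [Group H] [Group Q]

/-- The orbits of `H` acting on `Q` by left multiplication through `φ`. -/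
abbrev CocycleOrbit (φ : H →* Q) : Type := Quotient (QuotientGroup.rightRel φ.range)

lemma card_cocycleOrbit (φ : H →* Q) : Nat.card (CocycleOrbit φ) = φ.range.index :=
  Nat.card_congr (QuotientGroup.quotientRightRelEquivQuotientLeftRel _)

lemma CocycleOrbit.mk_mul (φ : H →* Q) (h : H) (q : Q) :
    (⟦φ h * q⟧ : CocycleOrbit φ) = ⟦q⟧ :=
  Quotient.sound <| QuotientGroup.rightRel_apply.2 <| by
    simp [MonoidHom.mem_range]

/-- Each point is reached from the representative of its orbit, by the identity if it is the
representative itself. -/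
lemma exists_transport (φ : H →* Q) :
    ∃ t : Q → H, (∀ q, φ (t q) * (⟦q⟧ : CocycleOrbit φ).out = q) ∧
      ∀ o : CocycleOrbit φ, t o.out = 1 := by
  have key : ∀ q : Q, ∃ h : H, φ h * (⟦q⟧ : CocycleOrbit φ).out = q ∧
      (q = (⟦q⟧ : CocycleOrbit φ).out → h = 1) := by
    intro q
    by_cases hq : q = (⟦q⟧ : CocycleOrbit φ).out
    · exact ⟨1, by rw [map_one, one_mul]; exact hq.symm, fun _ => rfl⟩
    · obtain ⟨h, hh⟩ := QuotientGroup.rightRel_apply.1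
        (Quotient.mk_out (s := QuotientGroup.rightRel φ.range) q)
      exact ⟨h, by rw [hh, inv_mul_cancel_right], fun h' => absurd h' hq⟩
  choose t ht ht' using key
  exact ⟨t, ht, fun o => ht' _ (by rw [Quotient.out_eq])⟩

variable {X : Type} [Group X] {φ : H →* Q}

lemma return_mem_ker {t : Q → H} (ht : ∀ q, φ (t q) * (⟦q⟧ : CocycleOrbit φ).out = q)
    (h : H) (q : Q) : (t (φ h * q))⁻¹ * h * t q ∈ φ.ker := by
  have h1 := ht (φ h * q)
  rw [CocycleOrbit.mk_mul] at h1
  have h2 := ht q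
  rw [MonoidHom.mem_ker, map_mul, map_mul, map_inv, eq_mul_inv_of_mul_eq h1,
    eq_mul_inv_of_mul_eq h2]
  group

/-- The cocycle with prescribed holonomy `χ` on each orbit and prescribed potential `p`. -/
def ActionCocycle.ofHolonomy {t : Q → H} (ht : ∀ q, φ (t q) * (⟦q⟧ : CocycleOrbit φ).out = q)
    (χ : CocycleOrbit φ → φ.ker →* X) (p : Q → X) : ActionCocycle φ X where
  toFun h q := p (φ h * q) * χ ⟦q⟧ ⟨_, return_mem_ker ht h q⟩ * (p q)⁻¹
  toFun_mul g h q := by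
    have : (⟨_, return_mem_ker ht (g * h) q⟩ : φ.ker) =
        ⟨_, return_mem_ker ht g (φ h * q)⟩ * ⟨_, return_mem_ker ht h q⟩ := by
      ext
      simp [mul_assoc]
    have cancel : ∀ u v w a b : X, u * (a * b) * w⁻¹ = u * a * v⁻¹ * (v * b * w⁻¹) := by
      intros
      group
    rw [this, map_mul, CocycleOrbit.mk_mul, map_mul (χ _), mul_assoc (φ g)]
    exact cancel _ _ _ _ _

lemma ActionCocycle.ofHolonomy_toFun {t : Q → H}
    (ht : ∀ q, φ (t q) * (⟦q⟧ : CocycleOrbit φ).out = q)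
    (χ : CocycleOrbit φ → φ.ker →* X) (p : Q → X) {h : H} {q : Q} (k : φ.ker)
    (hk : (k : H) = (t (φ h * q))⁻¹ * h * t q) :
    (ofHolonomy ht χ p).toFun h q = p (φ h * q) * χ ⟦q⟧ k * (p q)⁻¹ := by
  obtain rfl : k = ⟨_, return_mem_ker ht h q⟩ := Subtype.ext hk
  rfl

/-- A cocycle is determined by its holonomies and its values along a transport. -/
lemma ActionCocycle.ext_transport {t : Q → H}
    (ht : ∀ q, φ (t q) * (⟦q⟧ : CocycleOrbit φ).out = q) {c d : ActionCocycle φ X}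
    (hker : ∀ o : CocycleOrbit φ, c.onKer o.out = d.onKer o.out)
    (hq : ∀ q, c.toFun (t q) (⟦q⟧ : CocycleOrbit φ).out =
      d.toFun (t q) (⟦q⟧ : CocycleOrbit φ).out) : c = d := by
  ext h q
  set o : CocycleOrbit φ := ⟦q⟧ with ho
  let k : φ.ker := ⟨_, return_mem_ker ht h q⟩
  have expand : ∀ e : ActionCocycle φ X,
      e.toFun h q * e.toFun (t q) o.out = e.toFun (t (φ h * q)) o.out * e.onKer o.out k := by
    intro e
    have h1 := e.toFun_mul h (t q) o.out
    rw [ht q] at h1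
    have h2 := e.toFun_mul (t (φ h * q)) k o.out
    rw [MonoidHom.mem_ker.1 k.2, one_mul] at h2
    have h3 : t (φ h * q) * (k : H) = h * t q := by simp [k, mul_assoc]
    rw [← h1, ← h3, h2]
    rfl
  have hq' := hq (φ h * q)
  rw [CocycleOrbit.mk_mul, ← ho] at hq'
  have := expand c
  rw [hker o, hq', ← expand d, hq q] at this
  exact mul_right_cancel this

/-- If the kernel is free on `B`, there is a cocycle basis with one loop for each orbit and each
element of `B`, and one edge for each point which is not an orbit representative. -/
theorem exists_isCocycleBasis {B : Type} (b : FreeGroupBasis B φ.ker) :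
    ∃ g : (CocycleOrbit φ × B) ⊕ ↥(Set.range (Quotient.out : CocycleOrbit φ → Q))ᶜ → H × Q,
      IsCocycleBasis φ g := by
  classical
  obtain ⟨t, ht, ht1⟩ := exists_transport φ
  refine ⟨Sum.elim (fun e => (b e.2, e.1.out))
    fun q => (t q, (⟦(q : Q)⟧ : CocycleOrbit φ).out), fun X _ => ⟨fun c d hcd => ?_, fun f => ?_⟩⟩
  · refine ActionCocycle.ext_transport ht
      (fun o => b.ext_hom _ _ fun i => congrFun hcd (.inl (o, i))) fun q => ?_
    by_cases hq : q ∈ Set.range (Quotient.out : CocycleOrbit φ → Q)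
    · obtain ⟨o, rfl⟩ := hq
      rw [ht1, c.toFun_one, d.toFun_one]
    · exact congrFun hcd (.inr ⟨q, hq⟩)
  · let p : Q → X := fun q =>
      if hq : q ∈ Set.range (Quotient.out : CocycleOrbit φ → Q) then 1 else f (.inr ⟨q, hq⟩)
    have hp : ∀ o : CocycleOrbit φ, p o.out = 1 := fun o => dif_pos ⟨o, rfl⟩
    refine ⟨ActionCocycle.ofHolonomy ht (fun o => b.lift fun i => f (.inl (o, i))) p, ?_⟩
    funext e
    rcases e with ⟨o, i⟩ | ⟨q, hq⟩
    · have hk : φ (b i : H) = 1 := MonoidHom.mem_ker.1 (b i).2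
      refine (ActionCocycle.ofHolonomy_toFun ht _ p (b i) (by simp [hk, ht1])).trans ?_
      simp [hk, hp]
    · refine (ActionCocycle.ofHolonomy_toFun ht _ p 1 (by simp [ht, ht1])).trans ?_
      simp only [Sum.elim_inr, hp, ht, map_one, inv_one, mul_one]
      exact dif_neg hq

lemma card_compl_range_out [Finite Q] :
    Nat.card ↥(Set.range (Quotient.out : CocycleOrbit φ → Q))ᶜ + φ.range.index = Nat.card Q := by
  have h := Set.ncard_add_ncard_compl (Set.range (Quotient.out : CocycleOrbit φ → Q))
  rw [← Nat.card_coe_set_eq, ← Nat.card_coe_set_eq,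
    Nat.card_range_of_injective Quotient.out_injective, card_cocycleOrbit] at h
  omega

/-- If the action groupoid is free, so is the kernel: it is a retract of a free group. -/
theorem IsCocycleBasis.isFreeGroup_ker {E : Type} {b : E → H × Q} (hb : IsCocycleBasis φ b) :
    IsFreeGroup φ.ker := by
  obtain ⟨t, ht, ht1⟩ := exists_transport φ
  let κ : ActionCocycle φ φ.ker := ActionCocycle.ofHolonomy ht (fun _ => MonoidHom.id _) 1
  obtain ⟨u, hu⟩ := (hb (FreeGroup E)).2 FreeGroup.of
  let π : FreeGroup E →* φ.ker := FreeGroup.lift fun e => κ.toFun (b e).1 (b e).2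
  have hπ : u.map π = κ := by
    refine (hb φ.ker).1 (funext fun e => ?_)
    have he : u.toFun (b e).1 (b e).2 = FreeGroup.of e := congrFun hu e
    simp [ActionCocycle.map, he, π]
  let q : Q := (⟦1⟧ : CocycleOrbit φ).out
  have hret : ∀ k : φ.ker, π (u.onKer q k) = k := by
    intro k
    have hk : φ (k : H) = 1 := MonoidHom.mem_ker.1 k.2
    have h1 : π (u.onKer q k) = κ.toFun k q :=
      congrFun (congrFun (congrArg ActionCocycle.toFun hπ) k) q
    refine h1.trans ((ActionCocycle.ofHolonomy_toFun ht _ 1 k (by simp [hk, q, ht1])).trans ?_)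
    simp
  have hinj : Injective (u.onKer q) := LeftInverse.injective hret
  exact IsFreeGroup.ofMulEquiv (MonoidHom.ofInjective hinj).symm

/-- Two cocycle bases have the same cardinality if one of them is finite. -/
lemma IsCocycleBasis.finite_and_card_eq {E E' : Type} [Finite E] {b : E → H × Q}
    {b' : E' → H × Q} (hb : IsCocycleBasis φ b) (hb' : IsCocycleBasis φ b') :
    Finite E' ∧ Nat.card E' = Nat.card E := by
  classical
  let e : (E → Multiplicative (ZMod 2)) ≃ (E' → Multiplicative (ZMod 2)) :=
    (Equiv.ofBijective _ (hb _)).symm.trans (Equiv.ofBijective _ (hb' _))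
  have hfin : Finite (E' → Multiplicative (ZMod 2)) := Finite.of_equiv _ e
  have hE' : Finite E' := by
    refine Finite.of_injective
      (fun i => (Pi.mulSingle i (Multiplicative.ofAdd 1) : E' → Multiplicative (ZMod 2))) ?_
    intro i j hij
    by_contra hne
    have := congrFun hij i
    simp only [Pi.mulSingle_eq_same, Pi.mulSingle_eq_of_ne hne] at this
    exact absurd this (by decide)
  refine ⟨hE', ?_⟩
  have hcard := Nat.card_congr e
  have h2 : Nat.card (Multiplicative (ZMod 2)) = 2 := Nat.card_zmod 2
  rw [Nat.card_fun, Nat.card_fun, h2] at hcard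
  exact (Nat.pow_right_injective le_rfl hcard).symm

/-- If the action groupoid of a surjection onto a finite group is free of rank `N`, then the kernel
is free of rank `N + 1 - |Q|`. -/
theorem IsCocycleBasis.nonempty_ker_mulEquiv [Finite Q] {E : Type} [Finite E] {b : E → H × Q}
    (hb : IsCocycleBasis φ b) (hφ : Surjective φ) :
    Nonempty (φ.ker ≃* FreeGroup (Fin (Nat.card E + 1 - Nat.card Q))) := by
  obtain ⟨B, ⟨β⟩⟩ := hb.isFreeGroup_ker.nonempty_basis
  obtain ⟨g, hg⟩ := exists_isCocycleBasis β
  obtain ⟨hfin, hcard⟩ := hb.finite_and_card_eq hg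
  have hB : Finite B := Finite.of_injective
    (fun i => (Sum.inl ((⟦1⟧ : CocycleOrbit φ), i) :
      (CocycleOrbit φ × B) ⊕ ↥(Set.range (Quotient.out : CocycleOrbit φ → Q))ᶜ))
    fun i j hij => by simpa using hij
  have hidx : φ.range.index = 1 := by
    rw [Subgroup.index_eq_one, MonoidHom.range_eq_top.2 hφ]
  have hS := card_compl_range_out (φ := φ)
  rw [Nat.card_sum, Nat.card_prod, card_cocycleOrbit, hidx] at hcard
  rw [hidx] at hS
  have hN : Nat.card B = Nat.card E + 1 - Nat.card Q := by omega
  exact ⟨β.repr.trans (FreeGroup.freeGroupCongr (Finite.equivFinOfCardEq hN))⟩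

end Kernel

section Factors

variable {H Q : Type} [Group H] [Group Q] [Finite Q] {φ : H →* Q}

/-- If the kernel embeds in `ℤ`, the action groupoid has rank `|Q|`. -/
lemma exists_isCocycleBasis_of_infinite [Infinite H] (p : H →* Multiplicative ℤ)
    (hp : ∀ x, φ x = 1 → p x = 1 → x = 1) :
    ∃ (E : Type) (g : E → H × Q), Finite E ∧ Nat.card E = Nat.card Q ∧ IsCocycleBasis φ g := by
  have hinj : Injective (p.comp φ.ker.subtype) := by
    rw [injective_iff_map_eq_one]
    exact fun x hx => Subtype.ext (hp x x.2 hx)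
  have : IsCyclic φ.ker := isCyclic_of_injective _ hinj
  have : Infinite φ.ker := by
    by_contra hfin
    rw [not_infinite_iff_finite] at hfin
    have h := φ.ker.card_mul_index
    rw [Subgroup.index_ker] at h
    have : Finite H := Nat.finite_of_card_ne_zero
      (h ▸ mul_ne_zero Nat.card_pos.ne' Nat.card_pos.ne')
    exact not_finite H
  let b : FreeGroupBasis Unit φ.ker :=
    ⟨(FreeGroup.mulEquivIntOfUnique.trans intCyclicMulEquiv).symm⟩
  obtain ⟨g, hg⟩ := exists_isCocycleBasis b
  refine ⟨_, g, inferInstance, ?_, hg⟩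
  rw [Nat.card_sum, Nat.card_prod, card_cocycleOrbit, ← card_compl_range_out (φ := φ)]
  simp [add_comm]

/-- If `φ` is injective, the action groupoid has rank `|Q|` minus the number of orbits. -/
lemma exists_isCocycleBasis_of_injective (hφ : Injective φ) :
    ∃ (E : Type) (g : E → H × Q), Finite E ∧ (Nat.card E + Nat.card Q / Nat.card H = Nat.card Q) ∧
      IsCocycleBasis φ g := by
  have hker : φ.ker = ⊥ := (MonoidHom.ker_eq_bot_iff φ).2 hφ
  have : Subsingleton φ.ker := by rw [hker]; infer_instance
  have : Unique φ.ker := uniqueOfSubsingleton 1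
  let b : FreeGroupBasis Empty φ.ker := ⟨MulEquiv.ofUnique⟩
  obtain ⟨g, hg⟩ := exists_isCocycleBasis b
  have hcard : Nat.card φ.range = Nat.card H :=
    (Nat.card_congr (MonoidHom.ofInjective hφ).toEquiv).symm
  have hidx : φ.range.index = Nat.card Q / Nat.card H := by
    rw [← hcard, ← φ.range.index_mul_card, Nat.mul_div_cancel _ Nat.card_pos]
  refine ⟨_, g, inferInstance, ?_, hg⟩
  rw [← hidx, Nat.card_sum, ← card_compl_range_out (φ := φ)]
  simp

end Factors

/-- If `φ` is injective on the powers of `f y`, with `f` injective, then `φ ∘ f` kills no nontrivial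
power of `y`. -/
lemma eq_one_of_injOn_zpowers {G M Q : Type} [Group G] [Group M] [Group Q] {φ : G →* Q} {f : M →* G}
    (hf : Injective f) {y : M} (h : Set.InjOn φ (Subgroup.zpowers (f y) : Set G)) {x : M}
    (hx : x ∈ Subgroup.zpowers y) (h1 : φ (f x) = 1) : x = 1 := by
  obtain ⟨k, rfl⟩ := hx
  refine hf ?_
  rw [map_one]
  exact h ⟨k, by simp⟩ (one_mem _) (h1.trans (map_one φ).symm)

lemma mem_zpowers_ofAdd_one {k : ℕ} (x : Multiplicative (ZMod k)) :
    x ∈ Subgroup.zpowers (Multiplicative.ofAdd (1 : ZMod k)) := by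
  refine ⟨(x.toAdd.cast : ℤ), ?_⟩
  change (Multiplicative.ofAdd (1 : ZMod k)) ^ (x.toAdd.cast : ℤ) = x
  rw [← ofAdd_zsmul]
  simp

lemma mem_zpowers_ofAdd_one_zero {k : ℕ} {x : Multiplicative (ZMod k × ℤ)} (hx : x.toAdd.2 = 0) :
    x ∈ Subgroup.zpowers (Multiplicative.ofAdd ((1, 0) : ZMod k × ℤ)) := by
  refine ⟨(x.toAdd.1.cast : ℤ), ?_⟩
  change (Multiplicative.ofAdd ((1, 0) : ZMod k × ℤ)) ^ (x.toAdd.1.cast : ℤ) = x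
  rw [← ofAdd_zsmul]
  refine Multiplicative.toAdd.injective (Prod.ext ?_ ?_) <;> simp [hx]

/-- The rank of the action groupoid of each factor. -/
def facRank (r s t m n : ℕ) : Idx r s t m n → ℕ
  | .inl _ => 4
  | .inr (.inl _) => 4
  | .inr (.inr (.inl _)) => 3
  | .inr (.inr (.inr (.inl _))) => 4
  | .inr (.inr (.inr (.inr _))) => 2

lemma sum_facRank (r s t m n : ℕ) :
    ∑ i, facRank r s t m n i = 4 * (r + s + m) + 3 * t + 2 * n := by
  simp only [Fintype.sum_sum_type, facRank, Finset.sum_const, Finset.card_univ, Fintype.card_fin,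
    smul_eq_mul]
  ring

lemma exists_isCocycleBasis_fac {r s t m n : ℕ}
    {lam : OrbGroup r s t m n →* Multiplicative (ZMod 4)}
    (hinj : InjOnTorsion lam) (i : Idx r s t m n) :
    ∃ (E : Type) (g : E → Fac r s t m n i × Multiplicative (ZMod 4)),
      Finite E ∧ Nat.card E = facRank r s t m n i ∧
        IsCocycleBasis (lam.comp (CoprodI.of (i := i))) g := by
  obtain ⟨hB, hD, hE, hG⟩ := hinj
  have hof : ∀ i, Injective (CoprodI.of : Fac r s t m n i →* _) := CoprodI.of_injective
  have h4 : Nat.card (Multiplicative (ZMod 4)) = 4 := Nat.card_zmod 4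
  have h2 : Nat.card (Multiplicative (ZMod 2)) = 2 := Nat.card_zmod 2
  match i with
  | .inl i =>
    obtain ⟨E, g, hfin, hcard, hg⟩ := exists_isCocycleBasis_of_infinite
      (H := Multiplicative ℤ) (φ := lam.comp (CoprodI.of (M := Fac r s t m n) (i := .inl i)))
      (MonoidHom.id _) fun x _ hx => hx
    exact ⟨E, g, hfin, hcard.trans h4, hg⟩
  | .inr (.inl j) =>
    have : Infinite (Multiplicative (ZMod 4 × ℤ)) := inferInstanceAs (Infinite (ZMod 4 × ℤ))
    obtain ⟨E, g, hfin, hcard, hg⟩ := exists_isCocycleBasis_of_infinite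
      (H := Multiplicative (ZMod 4 × ℤ))
      (φ := lam.comp (CoprodI.of (M := Fac r s t m n) (i := .inr (.inl j))))
      (AddMonoidHom.snd (ZMod 4) ℤ).toMultiplicative fun x h1 hx =>
        eq_one_of_injOn_zpowers (hof (.inr (.inl j))) (hB j) (mem_zpowers_ofAdd_one_zero hx) h1
    exact ⟨E, g, hfin, hcard.trans h4, hg⟩
  | .inr (.inr (.inl k)) =>
    obtain ⟨E, g, hfin, hcard, hg⟩ := exists_isCocycleBasis_of_injective
      (H := Multiplicative (ZMod 4))
      (φ := lam.comp (CoprodI.of (M := Fac r s t m n) (i := .inr (.inr (.inl k)))))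
      ((injective_iff_map_eq_one _).2 fun x h1 =>
        eq_one_of_injOn_zpowers (hof (.inr (.inr (.inl k)))) (hD k) (mem_zpowers_ofAdd_one x) h1)
    rw [h4] at hcard
    exact ⟨E, g, hfin, Nat.add_right_cancel hcard, hg⟩
  | .inr (.inr (.inr (.inl l))) =>
    have : Infinite (Multiplicative (ZMod 2 × ℤ)) := inferInstanceAs (Infinite (ZMod 2 × ℤ))
    obtain ⟨E, g, hfin, hcard, hg⟩ := exists_isCocycleBasis_of_infinite
      (H := Multiplicative (ZMod 2 × ℤ))
      (φ := lam.comp (CoprodI.of (M := Fac r s t m n) (i := .inr (.inr (.inr (.inl l))))))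
      (AddMonoidHom.snd (ZMod 2) ℤ).toMultiplicative fun x h1 hx =>
        eq_one_of_injOn_zpowers (hof (.inr (.inr (.inr (.inl l))))) (hE l)
          (mem_zpowers_ofAdd_one_zero hx) h1
    exact ⟨E, g, hfin, hcard.trans h4, hg⟩
  | .inr (.inr (.inr (.inr q))) =>
    obtain ⟨E, g, hfin, hcard, hg⟩ := exists_isCocycleBasis_of_injective
      (H := Multiplicative (ZMod 2))
      (φ := lam.comp (CoprodI.of (M := Fac r s t m n) (i := .inr (.inr (.inr (.inr q))))))
      ((injective_iff_map_eq_one _).2 fun x h1 =>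
        eq_one_of_injOn_zpowers (hof (.inr (.inr (.inr (.inr q))))) (hG q)
          (mem_zpowers_ofAdd_one x) h1)
    rw [h4, h2] at hcard
    exact ⟨E, g, hfin, Nat.add_right_cancel hcard, hg⟩

/-- The kernel of a finite injective epimorphism `λ : G(r,s,t,m,n) → ℤ/4` is a free
group of rank `g = 4(r+s+m) + 3t + 2n − 3` (the genus of the covering handlebody). -/
theorem ker_free {r s t m n : ℕ} (h : 0 < r + s + t + m + n)
    (lam : OrbGroup r s t m n →* Multiplicative (ZMod 4))
    (hsurj : Function.Surjective lam) (hinj : InjOnTorsion lam) :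
    Nonempty (lam.ker ≃* FreeGroup (Fin (4 * (r + s + m) + 3 * t + 2 * n - 3))) := by
  choose E g hfin hcard hg using exists_isCocycleBasis_fac hinj
  have h4 : Nat.card (Multiplicative (ZMod 4)) = 4 := Nat.card_zmod 4
  have := (IsCocycleBasis.coprod hg).nonempty_ker_mulEquiv hsurj
  rwa [Nat.card_sigma, Finset.sum_congr rfl fun i _ => hcard i, sum_facRank, h4,
    Nat.add_sub_add_right _ 1 3] at this
end
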